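/- Let $a\in\mathbb{R}\setminus\{0\}$, let $\phi\in\mathscr{B}^\infty(\mathbb{R})$ with $\int_{\mathbb{R}}\phi(x)\,dx<\infty$, set $\Phi(x)=\int_0^x\phi(y)\,dy$, let $r>0$, and let $\varphi\in C^\infty(\mathbb{R})$ satisfy $0\le\varphi\le1$, $\varphi(\xi)=1$ for $|\xi|\ge r+1$ and $\varphi(\xi)=0$ for $|\xi|\le r$. Define $\tilde\Lambda v(x) = \Phi(x)\,\mathcal{F}^{-1}\big[\tfrac{\varphi(\xi)}{4a\xi}\,\mathcal{F}v(\xi)\big](x)$. Then there exists a constant $C>0$ such that for every Schwartz function $v$ on $\mathbb{R}$, $\big\| \sqrt{-1}\,a\,\big(\tilde\Lambda(\partial_x^4 v) - \partial_x^4(\tilde\Lambda v)\big) - \phi\, v_{xx} - \tfrac{3}{2}\,\phi'\, v_x \big\|_{L^2(\mathbb{R})} \le C\,\|v\|_{L^2(\mathbb{R})}$; that is, the commutator $\sqrt{-1}\,a\,[\tilde\Lambda,\partial_x^4]$ equals $\phi\,\partial_x^2 + \tfrac{3}{2}\phi'\,\partial_x$ modulo an $L^2$-bounded operator. -/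

import Mathlib

open MeasureTheory

/-- Fourier transform with the convention `𝓕f(ξ) = ∫ e^{-i x ξ} f(x) dx`. -/
noncomputable def paperFT (f : ℝ → ℂ) (ξ : ℝ) : ℂ :=
  ∫ x : ℝ, Complex.exp (-(Complex.I * (x : ℂ) * (ξ : ℂ))) * f x

/-- Inverse Fourier transform `(2π)⁻¹ ∫ e^{i x ξ} g(ξ) dξ`. -/
noncomputable def paperFTInv (g : ℝ → ℂ) (x : ℝ) : ℂ :=
  ((2 * Real.pi : ℝ) : ℂ)⁻¹ * ∫ ξ : ℝ, Complex.exp (Complex.I * (x : ℂ) * (ξ : ℂ)) * g ξ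

/-- The gauge operator `Λ̃ v (x) = Φ(x) · 𝓕⁻[ χ(ξ)/(4aξ) · 𝓕v(ξ) ](x)`. -/
noncomputable def gaugeOp (a : ℝ) (Φ χ : ℝ → ℝ) (v : ℝ → ℂ) : ℝ → ℂ :=
  fun x => ((Φ x : ℝ) : ℂ) *
    paperFTInv (fun ξ => ((χ ξ / (4 * a * ξ) : ℝ) : ℂ) * paperFT v ξ) x

open scoped FourierTransform SchwartzMap Real

theorem Function.HasTemperateGrowth.div_of_eq_one_of_eq_zero {χ : ℝ → ℝ} {r : ℝ} (hr : 0 < r)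
    (hχ : ContDiff ℝ (⊤ : ℕ∞) χ) (hχ1 : ∀ ξ : ℝ, r + 1 ≤ |ξ| → χ ξ = 1)
    (hχ0 : ∀ ξ : ℝ, |ξ| ≤ r → χ ξ = 0) :
    Function.HasTemperateGrowth (fun ξ => χ ξ / ξ) := by
  have hsmooth : ContDiff ℝ (⊤ : ℕ∞) (fun ξ => χ ξ / ξ) := by
    rw [contDiff_iff_contDiffAt]
    intro ξ
    rcases lt_or_ge |ξ| r with h | h
    · have : (fun ξ => χ ξ / ξ) =ᶠ[nhds ξ] fun _ => 0 := by
        filter_upwards [continuous_abs.continuousAt.eventually_lt_const h] with y hy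
        simp [hχ0 y hy.le]
      exact contDiffAt_const.congr_of_eventuallyEq this
    · exact hχ.contDiffAt.div contDiffAt_id (abs_pos.1 (hr.trans_le h))
  refine ⟨hsmooth, fun n => ⟨0, ?_⟩⟩
  simp only [pow_zero, mul_one, norm_iteratedFDeriv_eq_norm_iteratedDeriv]
  obtain ⟨B, hB⟩ := (isCompact_Icc (a := -(r + 1)) (b := r + 1)).exists_bound_of_continuousOn
    (hsmooth.continuous_iteratedDeriv n (by exact_mod_cast le_top)).continuousOn
  refine ⟨max B n.factorial, fun ξ => ?_⟩
  rcases le_or_gt |ξ| (r + 1) with h | h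
  · exact (hB ξ (abs_le.1 h)).trans (le_max_left _ _)
  · have heq : (fun ξ => χ ξ / ξ) =ᶠ[nhds ξ] fun ξ => ξ⁻¹ := by
      filter_upwards [continuous_abs.continuousAt.eventually_const_lt h] with y hy
      simp [hχ1 y hy.le]
    refine le_trans ?_ (le_max_right _ _)
    rw [heq.iteratedDeriv_eq, iteratedDeriv_eq_iterate, iter_deriv_inv, norm_mul, norm_mul,
      norm_pow, norm_neg, norm_one, one_pow, one_mul, norm_zpow, Real.norm_natCast, Real.norm_eq_abs]
    refine mul_le_of_le_one_right (by positivity) ?_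
    exact zpow_le_one_of_nonpos₀ (by linarith) (by omega)

theorem paperFT_eq_fourier (f : ℝ → ℂ) (ξ : ℝ) : paperFT f ξ = 𝓕 f (ξ / (2 * π)) := by
  rw [paperFT, Real.fourier_eq']
  congr 1 with x
  rw [smul_eq_mul]
  congr 2
  have : (π : ℂ) ≠ 0 := by exact_mod_cast Real.pi_ne_zero
  simp
  field_simp

theorem paperFTInv_eq_fourierInv (g : ℝ → ℂ) (x : ℝ) :
    paperFTInv g x = 𝓕⁻ (fun η => g (2 * π * η)) x := by
  rw [paperFTInv, Real.fourierInv_eq']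
  have h := Measure.integral_comp_mul_left
    (fun ξ : ℝ => Complex.exp (Complex.I * (x : ℂ) * (ξ : ℂ)) * g ξ) (2 * π)
  rw [abs_of_pos (by positivity), Complex.real_smul, Complex.ofReal_inv] at h
  rw [← h]
  congr 1 with η
  rw [smul_eq_mul]
  congr 2
  simp
  ring

theorem gaugeOp_eq_fourierMultiplier (a : ℝ) (Φ χ : ℝ → ℝ)
    (h : Function.HasTemperateGrowth
      (fun η : ℝ => ((χ (2 * π * η) / (4 * a * (2 * π * η)) : ℝ) : ℂ)))
    (v : 𝓢(ℝ, ℂ)) (x : ℝ) :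
    gaugeOp a Φ χ v x = (Φ x : ℂ) * SchwartzMap.fourierMultiplierCLM ℂ
      (fun η : ℝ => ((χ (2 * π * η) / (4 * a * (2 * π * η)) : ℝ) : ℂ)) v x := by
  rw [gaugeOp, paperFTInv_eq_fourierInv, SchwartzMap.fourierMultiplierCLM_apply,
    SchwartzMap.fourierInv_coe]
  congr 2
  refine congrFun (congrArg _ (funext fun η => ?_)) x
  rw [SchwartzMap.smulLeftCLM_apply_apply h, paperFT_eq_fourier, SchwartzMap.fourier_coe,
    mul_div_cancel_left₀ _ (by positivity), smul_eq_mul]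

theorem SchwartzMap.eLpNorm_fourier_two (f : 𝓢(ℝ, ℂ)) :
    eLpNorm (𝓕 f : 𝓢(ℝ, ℂ)) 2 volume = eLpNorm f 2 volume := by
  have h := SchwartzMap.norm_fourier_toL2_eq f
  rw [SchwartzMap.norm_toLp (f := f), SchwartzMap.norm_toLp (f := (𝓕 f : 𝓢(ℝ, ℂ)))] at h
  exact (ENNReal.toReal_eq_toReal_iff' ((𝓕 f : 𝓢(ℝ, ℂ)).memLp 2 volume).2.ne
    (f.memLp 2 volume).2.ne).1 h

theorem SchwartzMap.eLpNorm_fourierMultiplierCLM_le {m : ℝ → ℂ} (hm : m.HasTemperateGrowth)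
    {K : ℝ} (hK : ∀ η, ‖m η‖ ≤ K) (f : 𝓢(ℝ, ℂ)) :
    eLpNorm (fourierMultiplierCLM ℂ m f) 2 volume ≤
      ENNReal.ofReal K * eLpNorm f 2 volume := by
  rw [← eLpNorm_fourier_two, fourierMultiplierCLM_apply, FourierTransform.fourier_fourierInv_eq,
    ← eLpNorm_fourier_two f]
  refine eLpNorm_le_mul_eLpNorm_of_ae_le_mul (Filter.Eventually.of_forall fun η => ?_) 2
  rw [smulLeftCLM_apply_apply hm, norm_smul]
  gcongr
  exact hK η

theorem SchwartzMap.derivCLM_eq_fourierMultiplierCLM (f : 𝓢(ℝ, ℂ)) :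
    derivCLM ℂ ℂ f = fourierMultiplierCLM ℂ (fun η : ℝ => 2 * π * Complex.I * (η : ℂ)) f := by
  have h := lineDeriv_eq_fourierMultiplierCLM (1 : ℝ) f
  have h2 : (2 * π * Complex.I) • fourierMultiplierCLM ℂ (fun η : ℝ => (η : ℂ)) f =
      fourierMultiplierCLM ℂ (fun η : ℝ => 2 * π * Complex.I * (η : ℂ)) f := by
    have := fourierMultiplierCLM_smul (F := ℂ) (𝕜 := ℂ) (g := fun η : ℝ => (η : ℂ)) (by fun_prop)
      (2 * π * Complex.I)
    exact (congrArg (fun T => T f) this).symm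
  rw [← h2]
  have h3 := fourierMultiplierCLM_ofReal (F := ℂ) ℂ (g := fun η : ℝ => η) (by fun_prop) f
  have h4 : (fun x : ℝ => inner ℝ x 1) = fun x => x := by ext; simp
  rw [h4, ← h3] at h
  refine Eq.trans ?_ h
  ext x
  simp [lineDerivOp_apply_eq_fderiv]

theorem SchwartzMap.iteratedDeriv_eq_iterate_derivCLM (n : ℕ) (f : 𝓢(ℝ, ℂ)) :
    iteratedDeriv n f = ((derivCLM ℂ ℂ)^[n] f : 𝓢(ℝ, ℂ)) := by
  induction n generalizing f with
  | zero => simp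
  | succ n ih =>
    rw [iteratedDeriv_succ', Function.iterate_succ_apply, ← ih]
    rfl

theorem SchwartzMap.iterate_derivCLM_eq_fourierMultiplierCLM (n : ℕ) (f : 𝓢(ℝ, ℂ)) :
    (derivCLM ℂ ℂ)^[n] f =
      fourierMultiplierCLM ℂ (fun η : ℝ => (2 * π * Complex.I * (η : ℂ)) ^ n) f := by
  induction n with
  | zero => simp
  | succ n ih =>
    rw [Function.iterate_succ_apply', ih, derivCLM_eq_fourierMultiplierCLM,
      fourierMultiplierCLM_fourierMultiplierCLM_apply (by fun_prop) (by fun_prop)]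
    congr 1
    congr 1
    ext η
    simp [pow_succ']

theorem iteratedDeriv_ofReal_comp {f : ℝ → ℝ} (hf : ContDiff ℝ (⊤ : ℕ∞) f) (n : ℕ) :
    iteratedDeriv n (fun x => (f x : ℂ)) = fun x => ((iteratedDeriv n f x : ℝ) : ℂ) := by
  induction n with
  | zero => simp
  | succ n ih =>
    ext x
    rw [iteratedDeriv_succ, ih, iteratedDeriv_succ]
    exact ((hf.differentiable_iteratedDeriv n (by exact_mod_cast WithTop.coe_lt_top n)) x
      ).hasDerivAt.ofReal_comp.deriv

/-- A family of functions indexed by Schwartz functions that is measurable and bounded in `L²` by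
the `L²` norm of the index. -/
def IsBoundedOnL2 (F : 𝓢(ℝ, ℂ) → ℝ → ℂ) : Prop :=
  ∃ C > 0, ∀ v, AEStronglyMeasurable (F v) volume ∧
    eLpNorm (F v) 2 volume ≤ ENNReal.ofReal C * eLpNorm v 2 volume

theorem IsBoundedOnL2.add {F G : 𝓢(ℝ, ℂ) → ℝ → ℂ} (hF : IsBoundedOnL2 F) (hG : IsBoundedOnL2 G) :
    IsBoundedOnL2 (fun v x => F v x + G v x) := by
  obtain ⟨A, hA, hF⟩ := hF
  obtain ⟨B, hB, hG⟩ := hG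
  refine ⟨A + B, by positivity, fun v => ⟨(hF v).1.add (hG v).1, ?_⟩⟩
  rw [ENNReal.ofReal_add hA.le hB.le, add_mul]
  exact (eLpNorm_add_le (hF v).1 (hG v).1 (by norm_num)).trans (add_le_add (hF v).2 (hG v).2)

theorem IsBoundedOnL2.mul_left {F : 𝓢(ℝ, ℂ) → ℝ → ℂ} (hF : IsBoundedOnL2 F) {c : ℝ → ℂ}
    (hc : Continuous c) {M : ℝ} (hM : ∀ x, ‖c x‖ ≤ M) :
    IsBoundedOnL2 (fun v x => c x * F v x) := by
  obtain ⟨A, hA, hF⟩ := hF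
  have hM0 : 0 ≤ M := (norm_nonneg _).trans (hM 0)
  refine ⟨(M + 1) * A, by positivity, fun v => ⟨hc.aestronglyMeasurable.mul (hF v).1, ?_⟩⟩
  rw [ENNReal.ofReal_mul (by positivity), mul_assoc]
  refine le_trans ?_ (mul_le_mul_right (hF v).2 _)
  refine eLpNorm_le_mul_eLpNorm_of_ae_le_mul (Filter.Eventually.of_forall fun x => ?_) 2
  rw [norm_mul]
  gcongr
  exact (hM x).trans (by linarith)

theorem isBoundedOnL2_fourierMultiplierCLM {m : ℝ → ℂ} (hm : m.HasTemperateGrowth)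
    {K : ℝ} (hK : ∀ η, ‖m η‖ ≤ K) :
    IsBoundedOnL2 (fun v => SchwartzMap.fourierMultiplierCLM ℂ m v) := by
  have hK0 : 0 ≤ K := (norm_nonneg _).trans (hK 0)
  exact ⟨K + 1, by positivity, fun v => ⟨(SchwartzMap.continuous _).aestronglyMeasurable,
    SchwartzMap.eLpNorm_fourierMultiplierCLM_le hm (fun η => (hK η).trans (by linarith)) v⟩⟩

theorem SchwartzMap.fourierMultiplierCLM_sub {g₁ g₂ : ℝ → ℂ} (h₁ : g₁.HasTemperateGrowth)
    (h₂ : g₂.HasTemperateGrowth) :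
    fourierMultiplierCLM ℂ (g₁ - g₂) = fourierMultiplierCLM ℂ g₁ - fourierMultiplierCLM ℂ g₂ := by
  rw [fourierMultiplierCLM, smulLeftCLM_sub h₁ h₂, ContinuousLinearMap.sub_comp,
    ContinuousLinearMap.comp_sub]
  rfl

theorem SchwartzMap.iteratedDeriv_fourierMultiplierCLM_sub {m : ℝ → ℂ} (hm : m.HasTemperateGrowth)
    (j k : ℕ) (c : ℂ) (v : 𝓢(ℝ, ℂ)) (x : ℝ) :
    iteratedDeriv j (fourierMultiplierCLM ℂ m v) x - c * iteratedDeriv k v x =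
      fourierMultiplierCLM ℂ (fun η : ℝ => (2 * π * Complex.I * (η : ℂ)) ^ j * m η -
        c * (2 * π * Complex.I * (η : ℂ)) ^ k) v x := by
  rw [iteratedDeriv_eq_iterate_derivCLM, iteratedDeriv_eq_iterate_derivCLM,
    iterate_derivCLM_eq_fourierMultiplierCLM, iterate_derivCLM_eq_fourierMultiplierCLM,
    fourierMultiplierCLM_fourierMultiplierCLM_apply (by fun_prop) hm]
  have hsmul := fourierMultiplierCLM_smul (F := ℂ) (𝕜 := ℂ)
    (g := fun η : ℝ => (2 * π * Complex.I * (η : ℂ)) ^ k) (by fun_prop) c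
  have hsub := fourierMultiplierCLM_sub
    (g₁ := fun η : ℝ => (2 * π * Complex.I * (η : ℂ)) ^ j * m η)
    (g₂ := fun η : ℝ => c * (2 * π * Complex.I * (η : ℂ)) ^ k) (by fun_prop) (by fun_prop)
  have h1 := congrArg (fun T => T v x) hsmul
  have h2 := congrArg (fun T => T v x) hsub
  exact (congrArg₂ (· - ·) rfl h1.symm).trans h2.symm

theorem SchwartzMap.fourierMultiplierCLM_iterate_derivCLM {m : ℝ → ℂ} (hm : m.HasTemperateGrowth)
    (n : ℕ) (v : 𝓢(ℝ, ℂ)) :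
    fourierMultiplierCLM ℂ m ((derivCLM ℂ ℂ)^[n] v) =
      (derivCLM ℂ ℂ)^[n] (fourierMultiplierCLM ℂ m v) := by
  rw [iterate_derivCLM_eq_fourierMultiplierCLM, iterate_derivCLM_eq_fourierMultiplierCLM,
    fourierMultiplierCLM_fourierMultiplierCLM_apply hm (by fun_prop),
    fourierMultiplierCLM_fourierMultiplierCLM_apply (by fun_prop) hm, mul_comm]

theorem norm_gauge_symbol_sub_le {χ : ℝ → ℝ} {r a : ℝ} (hr : 0 < r) (ha : a ≠ 0)
    (hχ01 : ∀ ξ, χ ξ ∈ Set.Icc (0 : ℝ) 1) (hχ1 : ∀ ξ : ℝ, r + 1 ≤ |ξ| → χ ξ = 1)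
    (hχ0 : ∀ ξ : ℝ, |ξ| ≤ r → χ ξ = 0) (k : ℕ) (η : ℝ) :
    ‖(2 * π * Complex.I * (η : ℂ)) ^ (k + 1) *
        ((χ (2 * π * η) / (4 * a * (2 * π * η)) : ℝ) : ℂ) -
      Complex.I / (4 * a) * (2 * π * Complex.I * (η : ℂ)) ^ k‖ ≤ (r + 1) ^ k / (4 * |a|) := by
  have haC : (a : ℂ) ≠ 0 := by exact_mod_cast ha
  obtain ⟨ξ, hξ⟩ : ∃ ξ, ξ = 2 * π * η := ⟨_, rfl⟩
  have hξC : 2 * π * Complex.I * (η : ℂ) = Complex.I * ξ := by rw [hξ]; push_cast; ring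
  rw [hξC, ← hξ]
  have key : (Complex.I * (ξ : ℂ)) ^ (k + 1) * ((χ ξ / (4 * a * ξ) : ℝ) : ℂ) -
      Complex.I / (4 * a) * (Complex.I * ξ) ^ k =
      Complex.I / (4 * a) * ((Complex.I * ξ) ^ k * ((χ ξ - 1 : ℝ) : ℂ)) := by
    rcases eq_or_ne ξ 0 with h | h
    · simp [h, hχ0 0 (by simpa using hr.le)]
    · have hC : (ξ : ℂ) ≠ 0 := by exact_mod_cast h
      push_cast
      field_simp
      ring
  rw [key]
  have hbound : |ξ| ^ k * |χ ξ - 1| ≤ (r + 1) ^ k := by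
    rcases le_or_gt (r + 1) |ξ| with h | h
    · rw [hχ1 ξ h, sub_self, abs_zero, mul_zero]
      positivity
    · have h1 : |χ ξ - 1| ≤ 1 := by
        obtain ⟨h0, h1⟩ := hχ01 ξ
        rw [abs_le]
        constructor <;> linarith
      calc |ξ| ^ k * |χ ξ - 1| ≤ (r + 1) ^ k * 1 := by gcongr
        _ = _ := mul_one _
  simp only [norm_mul, norm_div, norm_pow, Complex.norm_I, Complex.norm_real, Real.norm_eq_abs,
    one_mul, Complex.norm_ofNat]
  rw [one_div, mul_comm, ← div_eq_mul_inv]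
  gcongr

theorem abs_gauge_symbol_le {χ : ℝ → ℝ} {r a : ℝ} (hr : 0 < r)
    (hχ01 : ∀ ξ, χ ξ ∈ Set.Icc (0 : ℝ) 1) (hχ0 : ∀ ξ : ℝ, |ξ| ≤ r → χ ξ = 0) (ξ : ℝ) :
    |χ ξ / (4 * a * ξ)| ≤ 1 / (4 * |a| * r) := by
  rcases le_or_gt |ξ| r with h | h
  · rw [hχ0 ξ h, zero_div, abs_zero]
    positivity
  · rcases eq_or_ne a 0 with rfl | ha
    · simp
    rw [abs_div, abs_mul, abs_mul, abs_of_pos (four_pos : (0 : ℝ) < 4)]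
    have := abs_pos.2 ha
    gcongr
    obtain ⟨h0, h1⟩ := hχ01 ξ
    rwa [abs_of_nonneg h0]

theorem iteratedDeriv_four_mul {f w : ℝ → ℂ} (hf : ContDiff ℝ (⊤ : ℕ∞) f)
    (hw : ContDiff ℝ (⊤ : ℕ∞) w) (x : ℝ) :
    iteratedDeriv 4 (fun x => f x * w x) x =
      f x * iteratedDeriv 4 w x + 4 * iteratedDeriv 1 f x * iteratedDeriv 3 w x +
      6 * iteratedDeriv 2 f x * iteratedDeriv 2 w x +
      4 * iteratedDeriv 3 f x * iteratedDeriv 1 w x + iteratedDeriv 4 f x * w x := by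
  rw [iteratedDeriv_fun_mul (contDiff_infty.1 hf 4).contDiffAt
    (contDiff_infty.1 hw 4).contDiffAt]
  simp [Finset.sum_range_succ, Nat.choose]

/-- **Commutator expansion for the gauge transform.** With `Φ(x) = ∫₀ˣ φ`, the commutator
`√-1 a [Λ̃, ∂ₓ⁴]` equals `φ ∂ₓ² + (3/2) φ' ∂ₓ` modulo an `L²`-bounded operator: there is
`C > 0` with
`‖ i a (Λ̃(∂ₓ⁴v) - ∂ₓ⁴(Λ̃v)) - φ v_xx - (3/2) φ' v_x ‖_{L²} ≤ C ‖v‖_{L²}`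
for every Schwartz function `v`. -/
theorem gauge_commutator_expansion (a : ℝ) (ha : a ≠ 0)
    (φ : ℝ → ℝ) (hφ : ContDiff ℝ (⊤ : ℕ∞) φ)
    (hφb : ∀ n : ℕ, ∃ M : ℝ, ∀ x, |iteratedDeriv n φ x| ≤ M)
    (hφint : Integrable φ (volume : Measure ℝ))
    (Φ : ℝ → ℝ) (hΦ : ∀ x, Φ x = ∫ y in (0:ℝ)..x, φ y)
    (r : ℝ) (hr : 0 < r)
    (χ : ℝ → ℝ) (hχ : ContDiff ℝ (⊤ : ℕ∞) χ) (hχ01 : ∀ ξ, χ ξ ∈ Set.Icc (0:ℝ) 1)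
    (hχ1 : ∀ ξ : ℝ, r + 1 ≤ |ξ| → χ ξ = 1) (hχ0 : ∀ ξ : ℝ, |ξ| ≤ r → χ ξ = 0) :
    ∃ C > 0, ∀ v : SchwartzMap ℝ ℂ,
      eLpNorm (fun x =>
          Complex.I * (a : ℂ) * (gaugeOp a Φ χ (iteratedDeriv 4 ⇑v) x
              - iteratedDeriv 4 (gaugeOp a Φ χ ⇑v) x)
            - ((φ x : ℝ) : ℂ) * iteratedDeriv 2 (⇑v) x
            - (3 / 2 : ℂ) * ((deriv φ x : ℝ) : ℂ) * deriv (⇑v) x) 2 (volume : Measure ℝ) ≤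
        ENNReal.ofReal C * eLpNorm (⇑v) 2 (volume : Measure ℝ) := by
  have haC : (a : ℂ) ≠ 0 := by exact_mod_cast ha
  have hφC : ContDiff ℝ (⊤ : ℕ∞) (fun x => (φ x : ℂ)) := Complex.ofRealCLM.contDiff.comp hφ
  have hΦd : ∀ x, HasDerivAt (fun x => (Φ x : ℂ)) (φ x : ℂ) x := by
    intro x
    rw [funext hΦ]
    exact (intervalIntegral.integral_hasDerivAt_right (hφ.continuous.intervalIntegrable 0 x)
      (hφ.continuous.stronglyMeasurableAtFilter _ _) hφ.continuous.continuousAt).ofReal_comp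
  have hΦderiv : deriv (fun x => (Φ x : ℂ)) = fun x => (φ x : ℂ) := funext fun x => (hΦd x).deriv
  have hΦC : ContDiff ℝ (⊤ : ℕ∞) (fun x => (Φ x : ℂ)) :=
    contDiff_infty_iff_deriv.2 ⟨fun x => (hΦd x).differentiableAt, by rwa [hΦderiv]⟩
  have hΦiter : ∀ n x, iteratedDeriv (n + 1) (fun x => (Φ x : ℂ)) x =
      ((iteratedDeriv n φ x : ℝ) : ℂ) := fun n x => by
    rw [iteratedDeriv_succ', hΦderiv, iteratedDeriv_ofReal_comp hφ]
  obtain ⟨m, hm⟩ : ∃ m : ℝ → ℂ, m = fun η : ℝ =>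
    ((χ (2 * π * η) / (4 * a * (2 * π * η)) : ℝ) : ℂ) := ⟨_, rfl⟩
  have hmT : m.HasTemperateGrowth := by
    have h1 := Function.HasTemperateGrowth.div_of_eq_one_of_eq_zero hr hχ hχ1 hχ0
    have h2 : Function.HasTemperateGrowth fun η : ℝ => 2 * π * η := by fun_prop
    have h3 := (Function.HasTemperateGrowth.const ((4 * a)⁻¹)).mul (h1.comp h2)
    have h4 := Function.Complex.hasTemperateGrowth_ofReal.comp h3
    refine Eq.subst (motive := Function.HasTemperateGrowth) ?_ h4
    rw [hm]
    ext η
    simp only [Function.comp_apply, Pi.mul_apply]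
    congr 1
    field_simp
  have hcoef : ∀ (c : ℂ) (n : ℕ) {F : 𝓢(ℝ, ℂ) → ℝ → ℂ}, IsBoundedOnL2 F →
      IsBoundedOnL2 (fun v x => c * ((iteratedDeriv n φ x : ℝ) : ℂ) * F v x) := by
    intro c n F hF
    obtain ⟨M, hM⟩ := hφb n
    refine hF.mul_left (M := ‖c‖ * M) ?_ fun x => ?_
    · exact continuous_const.mul (Complex.continuous_ofReal.comp
        (hφ.continuous_iteratedDeriv n (by exact_mod_cast le_top)))
    · rw [norm_mul, Complex.norm_real, Real.norm_eq_abs]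
      gcongr
      exact hM x
  have hrem : ∀ k : ℕ, IsBoundedOnL2 (fun v x =>
      iteratedDeriv (k + 1) (SchwartzMap.fourierMultiplierCLM ℂ m v) x -
        Complex.I / (4 * a) * iteratedDeriv k v x) := by
    intro k
    simp only [SchwartzMap.iteratedDeriv_fourierMultiplierCLM_sub hmT]
    refine isBoundedOnL2_fourierMultiplierCLM (K := (r + 1) ^ k / (4 * |a|))
      (by fun_prop) fun η => ?_
    rw [hm]
    exact norm_gauge_symbol_sub_le hr ha hχ01 hχ1 hχ0 k η
  have hzero : IsBoundedOnL2 (fun v => SchwartzMap.fourierMultiplierCLM ℂ m v) := by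
    refine isBoundedOnL2_fourierMultiplierCLM hmT (K := 1 / (4 * |a| * r)) fun η => ?_
    rw [hm, Complex.norm_real]
    exact abs_gauge_symbol_le hr hχ01 hχ0 _
  have hid : IsBoundedOnL2 (fun v => v) :=
    ⟨1, one_pos, fun v => ⟨v.continuous.aestronglyMeasurable, by simp⟩⟩
  obtain ⟨C, hC, hbound⟩ := ((((hcoef (-4 * Complex.I * a) 0 (hrem 2)).add
    (hcoef (-6 * Complex.I * a) 1 (hrem 1))).add (hcoef (-4 * Complex.I * a) 2 (hrem 0))).add
    (hcoef 1 2 hid)).add (hcoef (-Complex.I * a) 3 hzero)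
  refine ⟨C, hC, fun v => le_of_eq_of_le (congrArg (eLpNorm · 2 volume) (funext fun x => ?_))
    (hbound v).2⟩
  have hgauge : ∀ v : 𝓢(ℝ, ℂ), gaugeOp a Φ χ v =
      fun x => (Φ x : ℂ) * SchwartzMap.fourierMultiplierCLM ℂ m v x := by
    subst hm
    exact fun v => funext fun x => gaugeOp_eq_fourierMultiplier a Φ χ hmT v x
  rw [SchwartzMap.iteratedDeriv_eq_iterate_derivCLM 4 v, hgauge, hgauge,
    iteratedDeriv_four_mul hΦC ((SchwartzMap.fourierMultiplierCLM ℂ m v).smooth _),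
    SchwartzMap.fourierMultiplierCLM_iterate_derivCLM hmT,
    ← SchwartzMap.iteratedDeriv_eq_iterate_derivCLM, hΦiter 0, hΦiter 1, hΦiter 2, hΦiter 3]
  simp only [Nat.reduceAdd, iteratedDeriv_zero, iteratedDeriv_one]
  have hI : Complex.I ^ 2 = -1 := Complex.I_sq
  field_simp
  ring_nf
  simp only [hI]
  ring
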